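/- Let T be a tree and let S be a connected component of the subgraph of T induced by the closed neighborhood N[Supp(T)], regarded as a tree in its own right. Then Supp(S) = Supp(T) ∩ V(S) and Core(S) = Core(T) ∩ V(S), where Core(G) := N(Supp(G)). -/

import Mathlib

open scoped Classical

namespace NullDecomp

variable {V : Type*}

/-- The null space of the real adjacency matrix of a graph. -/
def nullSpace [Fintype V] (G : SimpleGraph V) : Set (V → ℝ) :=
  {x | Matrix.mulVec (G.adjMatrix ℝ) x = 0}

/-- The support of the null space: vertices with a nonzero entry in some null vector. -/
def supportSet [Fintype V] (G : SimpleGraph V) : Set V :=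
  {v | ∃ x ∈ nullSpace G, x v ≠ 0}

/-- The (open) neighborhood of a set of vertices. -/
def nbhdSet (G : SimpleGraph V) (A : Set V) : Set V :=
  {v | ∃ u ∈ A, G.Adj u v}

/-- The closed neighborhood of a set of vertices. -/
def closedNbhd (G : SimpleGraph V) (A : Set V) : Set V :=
  A ∪ nbhdSet G A

/-- The core of a graph: the neighborhood of the support of the null space. -/
def coreSet [Fintype V] (G : SimpleGraph V) : Set V :=
  nbhdSet G (supportSet G)

/-- A tree is an S-tree if the closed neighborhood of its support is everything. -/
def IsSTree [Fintype V] (G : SimpleGraph V) : Prop :=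
  G.IsTree ∧ closedNbhd G (supportSet G) = Set.univ

/-- A matching: a set of edges of `G`, pairwise disjoint. -/
def IsMatchingSet (G : SimpleGraph V) (M : Finset (Sym2 V)) : Prop :=
  (↑M : Set (Sym2 V)) ⊆ G.edgeSet ∧
    ∀ e ∈ M, ∀ f ∈ M, e ≠ f → ∀ v : V, v ∈ e → v ∉ f

/-- A maximum matching. -/
def IsMaxMatching [Fintype V] (G : SimpleGraph V) (M : Finset (Sym2 V)) : Prop :=
  IsMatchingSet G M ∧ ∀ M' : Finset (Sym2 V), IsMatchingSet G M' → M'.card ≤ M.card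

/-- The matching number. -/
noncomputable def matchingNumber [Fintype V] (G : SimpleGraph V) : ℕ :=
  sSup {n | ∃ M : Finset (Sym2 V), IsMatchingSet G M ∧ M.card = n}

/-- An independent set of vertices. -/
def IsIndep (G : SimpleGraph V) (A : Set V) : Prop :=
  ∀ u ∈ A, ∀ w ∈ A, ¬ G.Adj u w

/-- The independence number. -/
noncomputable def indepNumber [Fintype V] (G : SimpleGraph V) : ℕ :=
  sSup {n | ∃ A : Set V, IsIndep G A ∧ A.ncard = n}

/-- A vertex cover. -/
def IsVertexCover (G : SimpleGraph V) (Cs : Set V) : Prop :=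
  ∀ e ∈ G.edgeSet, ∃ v ∈ Cs, v ∈ e

/-- The vertex cover number. -/
noncomputable def coverNumber [Fintype V] (G : SimpleGraph V) : ℕ :=
  sInf {n | ∃ Cs : Set V, IsVertexCover G Cs ∧ Cs.ncard = n}

/-- The nullity of a graph: dimension of the kernel of its adjacency matrix. -/
noncomputable def nullity [Fintype V] (G : SimpleGraph V) : ℕ :=
  Module.finrank ℝ (LinearMap.ker (Matrix.mulVecLin (G.adjMatrix ℝ)))

/-- The number of maximum matchings of a graph. -/
noncomputable def numMaxMatchings [Fintype V] (G : SimpleGraph V) : ℕ :=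
  Set.ncard {M : Finset (Sym2 V) | IsMaxMatching G M}

/-- `C` is (the vertex set of) a connected component of the subgraph of `T`
induced by the closed neighborhood of the support of `T`. -/
def IsSComponent [Fintype V] (T : SimpleGraph V) (C : Set V) : Prop :=
  ∃ c : (T.induce (closedNbhd T (supportSet T))).ConnectedComponent,
    C = Subtype.val '' c.supp

/-- `C` is (the vertex set of) a connected component of the subgraph of `T`
induced by the complement of the closed neighborhood of the support of `T`. -/
def IsNComponent [Fintype V] (T : SimpleGraph V) (C : Set V) : Prop :=
  ∃ c : (T.induce ((closedNbhd T (supportSet T))ᶜ)).ConnectedComponent,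
    C = Subtype.val '' c.supp

/-- The zero-extension to `ℝ^V` of the null space of the subgraph of `T` induced by `C`:
vectors vanishing outside `C` whose restriction to `C` is a null vector of `T.induce C`. -/
noncomputable def extNull [Fintype V] (T : SimpleGraph V) (C : Set V) : Submodule ℝ (V → ℝ) :=
  LinearMap.ker ((Matrix.mulVecLin ((T.induce C).adjMatrix ℝ)).comp
      (LinearMap.funLeft ℝ ℝ (Subtype.val : ↥C → V))) ⊓
  LinearMap.ker (LinearMap.funLeft ℝ ℝ (Subtype.val : ↥(Cᶜ) → V))

theorem mem_nullSpace_iff [Fintype V] {G : SimpleGraph V} {x : V → ℝ} :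
    x ∈ nullSpace G ↔ ∀ v, ∑ w, (if G.Adj v w then x w else 0) = 0 := by
  simp [nullSpace, funext_iff, Matrix.mulVec, dotProduct, SimpleGraph.adjMatrix_apply]

/-- Two null vectors of a graph are proportional on the ends of a bridge. -/
theorem mul_eq_mul_of_isBridge [Fintype V] {G : SimpleGraph V} {u v : V} (huv : G.Adj u v)
    (hb : G.IsBridge s(u, v)) {x y : V → ℝ} (hx : x ∈ nullSpace G) (hy : y ∈ nullSpace G) :
    x u * y v = x v * y u := by
  rw [mem_nullSpace_iff] at hx hy
  rw [SimpleGraph.isBridge_iff] at hb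
  let H := G.deleteEdges {s(u, v)}
  let r : V → ℝ := fun w => if H.Reachable u w then 1 else 0
  have hru : r u = 1 := if_pos (SimpleGraph.Reachable.refl u)
  have hrv : r v = 0 := if_neg hb
  have hr : ∀ a b, G.Adj a b → s(a, b) ≠ s(u, v) → r a = r b := by
    intro a b hab hne
    have hH : H.Adj a b := by
      rw [SimpleGraph.deleteEdges_adj]
      exact ⟨hab, hne⟩
    have : H.Reachable u a ↔ H.Reachable u b :=
      ⟨fun h => h.trans hH.reachable, fun h => h.trans hH.symm.reachable⟩
    simp only [r, this]
  have h1 : ∑ a, ∑ b, (if G.Adj a b then r a * x a * y b else 0) = 0 := by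
    refine Finset.sum_eq_zero fun a _ => ?_
    have h := congrArg (fun t => r a * x a * t) (hy a)
    simpa only [Finset.mul_sum, mul_ite, mul_zero] using h
  have h2 : ∑ a, ∑ b, (if G.Adj a b then r b * x a * y b else 0) = 0 := by
    rw [Finset.sum_comm]
    refine Finset.sum_eq_zero fun b _ => ?_
    have h := congrArg (fun t => r b * y b * t) (hx b)
    simp only [Finset.mul_sum, mul_ite, mul_zero] at h
    refine (Finset.sum_congr rfl fun a _ => ?_).trans h
    simp only [G.adj_comm a b, mul_right_comm]
  have hne : u ≠ v := huv.ne
  have hterm : ∀ a b, (if G.Adj a b then r a * x a * y b else 0) -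
      (if G.Adj a b then r b * x a * y b else 0) =
      (if a = u then if b = v then x u * y v else 0 else 0) -
        (if a = v then if b = u then x v * y u else 0 else 0) := by
    intro a b
    by_cases hab : G.Adj a b
    · by_cases he : s(a, b) = s(u, v)
      · rcases Sym2.eq_iff.1 he with ⟨rfl, rfl⟩ | ⟨rfl, rfl⟩
        · simp [huv, hru, hrv, hne]
        · simp [huv.symm, hru, hrv, hne.symm]
      · have h1 : ¬ (a = u ∧ b = v) := fun h => he (by rw [h.1, h.2])
        have h2 : ¬ (a = v ∧ b = u) := fun h => he (by rw [h.1, h.2, Sym2.eq_swap])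
        simp only [← ite_and, h1, h2, hr a b hab he, sub_self, if_false]
    · have h1 : ¬ (a = u ∧ b = v) := fun h => hab (h.1 ▸ h.2 ▸ huv)
      have h2 : ¬ (a = v ∧ b = u) := fun h => hab (h.1 ▸ h.2 ▸ huv.symm)
      simp only [← ite_and, h1, h2, hab, sub_self, if_false]
  have h3 := congrArg₂ (· - ·) h1 h2
  simp only [← Finset.sum_sub_distrib, hterm] at h3
  simp only [Finset.sum_sub_distrib, Finset.sum_ite_eq', Finset.sum_ite_irrel,
    Finset.sum_const_zero, Finset.mem_univ, if_true, sub_self] at h3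
  linarith

/-- Flipping signs on one side of a bipartition preserves the null space. -/
theorem sign_mul_mem_nullSpace [Fintype V] {G : SimpleGraph V} {σ : V → ℝ}
    (hσ : ∀ a b, G.Adj a b → σ b = -σ a) {x : V → ℝ} (hx : x ∈ nullSpace G) :
    (fun w => σ w * x w) ∈ nullSpace G := by
  rw [mem_nullSpace_iff] at hx ⊢
  intro v
  have h := congrArg (fun t => -σ v * t) (hx v)
  simp only [Finset.mul_sum, mul_ite, mul_zero] at h
  refine (Finset.sum_congr rfl fun w _ => ?_).trans h
  split_ifs with hvw
  · rw [hσ v w hvw]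
  · rfl

/-- The support of a forest is an independent set. -/
theorem isIndep_supportSet [Fintype V] {G : SimpleGraph V} (hG : G.IsAcyclic) :
    IsIndep G (supportSet G) := by
  rintro u ⟨x, hx, hxu⟩ v ⟨y, hy, hyv⟩ huv
  have hb := SimpleGraph.isAcyclic_iff_forall_adj_isBridge.1 hG huv
  obtain ⟨c⟩ := hG.colorable_two
  let σ : V → ℝ := fun w => if c w = 0 then 1 else -1
  have hσ : ∀ a b, G.Adj a b → σ b = -σ a := by
    intro a b hab
    have := c.valid hab
    by_cases ha : c a = 0
    · have hb' : c b ≠ 0 := fun h => this (ha.trans h.symm)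
      simp [σ, ha, hb']
    · have hb' : c b = 0 := by omega
      simp [σ, ha, hb']
  have hσu : σ u ≠ 0 := by
    simp only [σ]
    split_ifs <;> norm_num
  have key : ∀ z ∈ nullSpace G, z u * z v = 0 := by
    intro z hz
    have h := mul_eq_mul_of_isBridge huv hb hz (sign_mul_mem_nullSpace hσ hz)
    simp only [hσ u v huv] at h
    have h' : σ u * (z u * z v) = 0 := by linarith
    exact (mul_eq_zero.1 h').resolve_left hσu
  have hxv : x v = 0 := (mul_eq_zero.1 (key x hx)).resolve_left hxu
  have h := mul_eq_mul_of_isBridge huv hb hx hy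
  rw [hxv, zero_mul] at h
  exact mul_ne_zero hxu hyv h

theorem IsSComponent.subset_closedNbhd [Fintype V] {T : SimpleGraph V} {C : Set V}
    (hC : IsSComponent T C) : C ⊆ closedNbhd T (supportSet T) := by
  obtain ⟨c, rfl⟩ := hC
  rintro _ ⟨w, -, rfl⟩
  exact w.2

theorem IsSComponent.mem_of_adj [Fintype V] {T : SimpleGraph V} {C : Set V}
    (hC : IsSComponent T C) {u w : V} (hu : u ∈ C) (huw : T.Adj u w)
    (hw : w ∈ closedNbhd T (supportSet T)) : w ∈ C := by
  obtain ⟨c, rfl⟩ := hC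
  obtain ⟨u, hu, rfl⟩ := hu
  have hadj : (T.induce (closedNbhd T (supportSet T))).Adj u ⟨w, hw⟩ := huw
  exact ⟨⟨w, hw⟩, (c.mem_supp_congr_adj hadj).1 hu, rfl⟩

/-- A null vector of a graph restricts to a null vector of any induced subgraph none of whose
vertices has an outside neighbor in the support. -/
theorem restrict_mem_nullSpace [Fintype V] {G : SimpleGraph V} {C : Set V} [Fintype C]
    (hC : ∀ u ∈ C, ∀ w ∈ supportSet G, G.Adj u w → w ∈ C) {x : V → ℝ} (hx : x ∈ nullSpace G) :
    (fun w : C => x w) ∈ nullSpace (G.induce C) := by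
  have hx' := hx
  rw [mem_nullSpace_iff] at hx' ⊢
  intro v
  refine (Fintype.sum_of_injective Subtype.val Subtype.val_injective _ _ ?_ ?_).trans (hx' v)
  · intro w hw
    rw [Subtype.range_coe] at hw
    split_ifs with hvw
    · by_contra hxw
      exact hw (hC v v.2 w ⟨x, hx, hxw⟩ hvw)
    · rfl
  · intro w
    simp

theorem IsSComponent.image_supportSet_induce [Fintype V] {T : SimpleGraph V} (hT : T.IsAcyclic)
    {C : Set V} [Fintype C] (hC : IsSComponent T C) :
    Subtype.val '' supportSet (T.induce C) = supportSet T ∩ C := by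
  have hsub : ∀ w : C, (w : V) ∈ supportSet T → w ∈ supportSet (T.induce C) := by
    rintro w ⟨x, hx, hxw⟩
    exact ⟨_, restrict_mem_nullSpace (fun _ hu _ hw huw => hC.mem_of_adj hu huw (Or.inl hw)) hx,
      hxw⟩
  refine Set.Subset.antisymm ?_ fun w hw => ⟨⟨w, hw.2⟩, hsub ⟨w, hw.2⟩ hw.1, rfl⟩
  rintro _ ⟨v, hv, rfl⟩
  refine ⟨(hC.subset_closedNbhd v.2).resolve_right ?_, v.2⟩
  rintro ⟨u, hu, huv⟩
  have huC : u ∈ C := hC.mem_of_adj v.2 huv.symm (Or.inl hu)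
  exact isIndep_supportSet (hT.induce C) ⟨u, huC⟩ (hsub ⟨u, huC⟩ hu) v hv huv

/-- For a connected component `S = T.induce C` of the subgraph of a tree `T` induced by
`N[Supp(T)]`: `Supp(S) = Supp(T) ∩ V(S)` and `Core(S) = Core(T) ∩ V(S)`. -/
theorem stmt13 [Fintype V] (T : SimpleGraph V) (hT : T.IsTree)
    (C : Set V) (hC : IsSComponent T C) :
    Subtype.val '' supportSet (T.induce C) = supportSet T ∩ C ∧
      Subtype.val '' coreSet (T.induce C) = coreSet T ∩ C := by
  have hsupp := hC.image_supportSet_induce hT.isAcyclic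
  refine ⟨hsupp, Set.Subset.antisymm ?_ ?_⟩
  · rintro _ ⟨v, ⟨u, hu, huv⟩, rfl⟩
    exact ⟨⟨u, (hsupp.subset ⟨u, hu, rfl⟩).1, huv⟩, v.2⟩
  · rintro v ⟨⟨u, hu, huv⟩, hv⟩
    obtain ⟨u, hu', rfl⟩ :=
      hsupp.superset ⟨hu, hC.mem_of_adj hv huv.symm (Or.inl hu)⟩
    exact ⟨⟨v, hv⟩, ⟨u, hu', huv⟩, rfl⟩

end NullDecomp
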